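/- For every natural number n ≥ 1, there is a bijection between the set of path components of the space C(S^{2n+1}, Γ_{n+1}⁺) and the homotopy group π_{2n+1}(Γ_{n+1}⁺, J₀). -/

import Mathlib

open Topology

/-- The unit sphere `S^m ⊆ ℝ^{m+1}` centered at the origin. -/
noncomputable def Sph (m : ℕ) : Set (EuclideanSpace ℝ (Fin (m + 1))) :=
  Metric.sphere (0 : EuclideanSpace ℝ (Fin (m + 1))) 1

/-- The north pole `N = (0, …, 0, 1) ∈ S^m`. -/
noncomputable def northPole (m : ℕ) : Sph m :=
  ⟨EuclideanSpace.single (Fin.last m) (1 : ℝ), by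
    simp [Sph, EuclideanSpace.norm_single]⟩

/-- The space `Γ_n` of orthogonal complex structures on `ℝ^{2n}`: real `(2n) × (2n)` matrices
`J` (with `Fin (2n)` identified with `Fin n ⊕ Fin n`) such that `Jᵀ * J = 1` and `J * J = -1`,
with the subspace topology. -/
def Gamma (n : ℕ) : Set (Matrix (Fin n ⊕ Fin n) (Fin n ⊕ Fin n) ℝ) :=
  {J | J.transpose * J = 1 ∧ J * J = -1}

/-- The standard complex structure `J₀` on `ℝ^{2n}`, given by the block matrix
`[[0, -1], [1, 0]]`. -/
def J0 (n : ℕ) : Matrix (Fin n ⊕ Fin n) (Fin n ⊕ Fin n) ℝ :=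
  Matrix.fromBlocks 0 (-1) 1 0

theorem J0_mem (n : ℕ) : J0 n ∈ Gamma n := by
  constructor
  · simp [J0, Matrix.fromBlocks_transpose, Matrix.fromBlocks_multiply, ← Matrix.fromBlocks_one]
  · have h : (-1 : Matrix (Fin n ⊕ Fin n) (Fin n ⊕ Fin n) ℝ)
        = Matrix.fromBlocks (-1) (-0) (-0) (-1) := by
      rw [← Matrix.fromBlocks_neg, Matrix.fromBlocks_one]
    simp [J0, Matrix.fromBlocks_multiply, h]

/-- `Γ_n⁺`: the path component of the standard complex structure `J₀` in `Γ_n`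
(the homogeneous space `SO(2n)/U(n)`). -/
noncomputable def GammaPlus (n : ℕ) : Set (Gamma n) :=
  pathComponent (⟨J0 n, J0_mem n⟩ : Gamma n)

/-- `Γ_n⁺` pointed at `J₀`. -/
noncomputable def J0plus (n : ℕ) : GammaPlus n :=
  ⟨⟨J0 n, J0_mem n⟩, mem_pathComponent_self _⟩

open scoped unitInterval Topology Topology.Homotopy

section Collapse

variable {N : Type*}

/-- The affine map from the unit cube to the cube `[-1, 1]^N`. -/
def cubeCenter (x : N → I) : N → ℝ := fun i => 2 * (x i : ℝ) - 1

theorem continuous_cubeCenter : Continuous (cubeCenter (N := N)) := by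
  unfold cubeCenter; fun_prop

variable [Fintype N]

theorem norm_cubeCenter_lt_one_iff (x : N → I) :
    ‖cubeCenter x‖ < 1 ↔ x ∉ Cube.boundary N := by
  rw [pi_norm_lt_iff one_pos]
  simp only [Cube.boundary, Set.mem_ofPred_eq, not_exists, not_or, cubeCenter, Real.norm_eq_abs,
    abs_lt]
  refine forall_congr' fun i => ?_
  have h0 := (x i).2.1
  have h1 := (x i).2.2
  rw [← Set.Icc.coe_eq_zero, ← Set.Icc.coe_eq_one]
  constructor
  · rintro ⟨h, h'⟩
    constructor <;> intro h'' <;> linarith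
  · rintro ⟨h, h'⟩
    have := lt_of_le_of_ne h0 (Ne.symm h)
    have := lt_of_le_of_ne h1 h'
    constructor <;> linarith

open Classical in
/-- The map collapsing the boundary of the cube to the point at infinity. -/
noncomputable def cubeCollapse (x : N → I) : OnePoint (N → ℝ) :=
  if x ∈ Cube.boundary N then OnePoint.infty
  else ((1 - ‖cubeCenter x‖)⁻¹ • cubeCenter x : N → ℝ)

theorem cubeCollapse_eq_infty_iff (x : N → I) :
    cubeCollapse x = OnePoint.infty ↔ x ∈ Cube.boundary N := by
  unfold cubeCollapse
  split_ifs with h <;> simp [h]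

theorem norm_inv_one_sub_smul {E : Type*} [NormedAddCommGroup E] [NormedSpace ℝ E] {u : E}
    (hu : ‖u‖ < 1) : ‖(1 - ‖u‖)⁻¹ • u‖ = (1 - ‖u‖)⁻¹ - 1 := by
  have : 0 < 1 - ‖u‖ := by linarith
  rw [norm_smul, norm_inv, Real.norm_of_nonneg this.le]
  field_simp
  ring

theorem cubeCollapse_injOn_compl_boundary :
    Set.InjOn (cubeCollapse (N := N)) (Cube.boundary N)ᶜ := by
  intro x hx y hy h
  have hx' := (norm_cubeCenter_lt_one_iff x).2 hx
  have hy' := (norm_cubeCenter_lt_one_iff y).2 hy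
  simp only [cubeCollapse, if_neg hx, if_neg hy, OnePoint.coe_eq_coe] at h
  have hn := congrArg norm h
  rw [norm_inv_one_sub_smul hx', norm_inv_one_sub_smul hy', sub_left_inj] at hn
  rw [hn] at h
  have h2 : (1 - ‖cubeCenter y‖)⁻¹ ≠ 0 := inv_ne_zero (by linarith)
  have h3 := smul_right_injective _ h2 h
  ext i
  have := congrFun h3 i
  simp only [cubeCenter] at this
  linarith

theorem cubeCollapse_surjective [Nonempty N] : Function.Surjective (cubeCollapse (N := N)) := by
  intro p
  induction p using OnePoint.rec with
  | infty =>
    exact ⟨0, (cubeCollapse_eq_infty_iff _).2 ⟨Classical.arbitrary N, Or.inl rfl⟩⟩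
  | coe w =>
    have hw : 0 < 1 + ‖w‖ := by positivity
    let u : N → ℝ := (1 + ‖w‖)⁻¹ • w
    have hnu : ‖u‖ = 1 - (1 + ‖w‖)⁻¹ := by
      rw [norm_smul, norm_inv, Real.norm_of_nonneg hw.le]
      field_simp
      ring
    have hu : ‖u‖ < 1 := by
      rw [hnu]
      have : 0 < (1 + ‖w‖)⁻¹ := by positivity
      linarith
    have hui := (pi_norm_lt_iff one_pos).1 hu
    simp only [Real.norm_eq_abs, abs_lt] at hui
    let x : N → I := fun i => ⟨(1 + u i) / 2, by linarith [hui i], by linarith [hui i]⟩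
    have hx : cubeCenter x = u := by
      ext i
      simp only [cubeCenter, x]
      ring
    have hb : x ∉ Cube.boundary N := by
      rw [← norm_cubeCenter_lt_one_iff, hx]
      exact hu
    refine ⟨x, ?_⟩
    rw [cubeCollapse, if_neg hb, hx, hnu]
    simp only [sub_sub_cancel, inv_inv, OnePoint.coe_eq_coe, u]
    rw [smul_smul, mul_inv_cancel₀ hw.ne', one_smul]

theorem isClosed_cube_boundary : IsClosed (Cube.boundary N) := by
  have : Cube.boundary N = {x | ‖cubeCenter x‖ < 1}ᶜ := by
    ext x
    simp [-not_lt, norm_cubeCenter_lt_one_iff]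
  rw [this]
  exact (isOpen_lt continuous_cubeCenter.norm continuous_const).isClosed_compl

theorem continuous_cubeCollapse : Continuous (cubeCollapse (N := N)) := by
  rw [continuous_iff_continuousAt]
  intro x
  by_cases hx : x ∈ Cube.boundary N
  · rw [ContinuousAt, (cubeCollapse_eq_infty_iff x).2 hx]
    have hx1 : ¬ ‖cubeCenter x‖ < 1 := by rwa [norm_cubeCenter_lt_one_iff, not_not]
    rw [OnePoint.hasBasis_nhds_infty.tendsto_right_iff]
    rintro s ⟨-, hs⟩
    obtain ⟨R, hR0, hR⟩ := hs.isBounded.exists_pos_norm_le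
    have hev : ∀ᶠ y in 𝓝 x, R * (1 - ‖cubeCenter y‖) < ‖cubeCenter y‖ := by
      refine ContinuousAt.eventually_lt (f := fun y => R * (1 - ‖cubeCenter y‖))
        (g := fun y => ‖cubeCenter y‖) ?_ ?_ ?_
      · exact (continuous_const.mul
          (continuous_const.sub continuous_cubeCenter.norm)).continuousAt
      · exact continuous_cubeCenter.norm.continuousAt
      · nlinarith
    filter_upwards [hev] with y hy
    by_cases hyb : y ∈ Cube.boundary N
    · right
      exact (cubeCollapse_eq_infty_iff y).2 hyb
    · left
      rw [cubeCollapse, if_neg hyb]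
      refine ⟨_, fun hmem => ?_, rfl⟩
      have hlt := (norm_cubeCenter_lt_one_iff y).2 hyb
      have hpos : 0 < 1 - ‖cubeCenter y‖ := by linarith
      have := hR _ hmem
      rw [norm_smul, norm_inv, Real.norm_of_nonneg hpos.le, inv_mul_le_iff₀ hpos] at this
      linarith
  · have hlt := (norm_cubeCenter_lt_one_iff x).2 hx
    have hev : ∀ᶠ y in 𝓝 x, y ∉ Cube.boundary N := isClosed_cube_boundary.isOpen_compl.mem_nhds hx
    have hc : ContinuousAt (fun y : N → I =>
        (((1 - ‖cubeCenter y‖)⁻¹ • cubeCenter y : N → ℝ) : OnePoint (N → ℝ))) x := by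
      refine OnePoint.continuous_coe.continuousAt.comp ?_
      refine ContinuousAt.smul (M := ℝ) (X := N → ℝ)
        (ContinuousAt.inv₀ ?_ (sub_pos.2 hlt).ne') continuous_cubeCenter.continuousAt
      exact (continuous_const.sub continuous_cubeCenter.norm).continuousAt
    refine hc.congr ?_
    filter_upwards [hev] with y hy
    rw [cubeCollapse, if_neg hy]

end Collapse

section FreeHomotopy

open ContinuousMap

theorem joined_of_continuous_prod {X Y : Type*} [TopologicalSpace X] [TopologicalSpace Y]
    {f g : C(Y, X)} (H : I × Y → X) (hH : Continuous H) (h0 : ∀ y, H (0, y) = f y)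
    (h1 : ∀ y, H (1, y) = g y) : Joined f g :=
  ⟨{ toContinuousMap := ContinuousMap.curry ⟨H, hH⟩
     source' := ContinuousMap.ext h0
     target' := ContinuousMap.ext h1 }⟩

/-- If every path starting at `x₀` can be moved back to `x₀` by an isotopy of `X` starting at the
identity, and if the end map of such an isotopy for a loop is homotopic to the identity relative to
`x₀`, then free homotopy classes of maps from a sphere to `X` are the same as elements of the
homotopy group of `X` at `x₀`. -/
theorem nonempty_zerothHomotopy_equiv_homotopyGroup {N X Y : Type*} [TopologicalSpace X]
    [TopologicalSpace Y] [LocallyCompactSpace Y] [PathConnectedSpace X] (x₀ : X)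
    (q : (N → I) → Y) (hq : IsQuotientMap q)
    (hqb : ∀ x ∈ Cube.boundary N, ∀ y ∈ Cube.boundary N, q x = q y)
    (hqi : ∀ x y, q x = q y → x = y ∨ x ∈ Cube.boundary N ∧ y ∈ Cube.boundary N)
    (hb : (Cube.boundary N).Nonempty)
    (hX : ∀ γ : C(I, X), γ 0 = x₀ → ∃ T : C(I × X, X), (∀ x, T (0, x) = x) ∧
      (∀ t, T (t, γ t) = x₀) ∧ (γ 1 = x₀ → ∃ S : C(I × X, X), (∀ x, S (0, x) = T (1, x)) ∧
        (∀ x, S (1, x) = x) ∧ ∀ s, S (s, x₀) = x₀)) :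
    Nonempty (ZerothHomotopy C(Y, X) ≃ HomotopyGroup N X x₀) := by
  obtain ⟨c, hc⟩ := hb
  let r : Y → (N → I) := Function.surjInv hq.surjective
  have hr : ∀ y, q (r y) = y := Function.surjInv_eq hq.surjective
  have hfac : ∀ {g : (N → I) → X}, (∀ x ∈ Cube.boundary N, g x = x₀) →
      ∀ x, g (r (q x)) = g x := by
    intro g hg x
    rcases hqi _ _ (hr (q x)) with h | ⟨h, h'⟩
    · rw [h]
    · rw [hg _ h, hg _ h']
  let F : GenLoop N X x₀ → C(Y, X) := fun f =>
    ⟨fun y => f (r y), hq.continuous_iff.2 (by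
      have : (fun y => f (r y)) ∘ q = f := funext (hfac f.2)
      rw [this]
      exact f.1.continuous)⟩
  have hF : ∀ f x, F f (q x) = f x := fun f x => hfac f.2 x
  have hFj : ∀ f g, GenLoop.Homotopic f g → Joined (F f) (F g) := by
    rintro f g ⟨H⟩
    refine joined_of_continuous_prod (fun p => H (p.1, r p.2)) ?_ ?_ ?_
    · refine hq.continuous_lift_prod_right ?_
      have : (fun p : I × (N → I) => H (p.1, r (q p.2))) = H := by
        ext ⟨t, x⟩
        exact hfac (g := fun x => H (t, x)) (fun x hx => (H.eq_fst t hx).trans (f.2 x hx)) x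
      rw [this]
      exact H.continuous
    · intro y
      simp [F]
    · intro y
      simp [F]
  let Φ : HomotopyGroup N X x₀ → ZerothHomotopy C(Y, X) :=
    Quotient.map (sa := GenLoop.Homotopic.setoid N x₀) (sb := pathSetoid C(Y, X)) F hFj
  have hΦ : Function.Bijective Φ := by
    constructor
    · intro a b
      induction a using Quotient.inductionOn with | _ f
      induction b using Quotient.inductionOn with | _ g
      intro h
      obtain ⟨P⟩ : Joined (F f) (F g) := Quotient.exact h
      let γ : C(I, X) := ⟨fun t => P t (q c), by fun_prop⟩
      have hγ0 : γ 0 = x₀ := by simp [γ, hF, GenLoop.boundary f c hc]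
      have hγ1 : γ 1 = x₀ := by simp [γ, hF, GenLoop.boundary g c hc]
      obtain ⟨T, hT0, hT, hS⟩ := hX γ hγ0
      obtain ⟨S, hS0, hS1, hS⟩ := hS hγ1
      have hPc : Continuous fun p : I × (N → I) => P p.1 (q p.2) := by
        have := hq.continuous
        fun_prop
      let k : GenLoop N X x₀ := ⟨⟨fun x => T (1, g x), by fun_prop⟩, fun x hx => by
        have := hT 1
        rw [hγ1] at this
        simpa [GenLoop.boundary g x hx] using this⟩
      have hk : ∀ x ∈ Cube.boundary N, k.1 x = x₀ := k.2
      have h1 : GenLoop.Homotopic f k := ⟨{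
        toFun := fun p => T (p.1, P p.1 (q p.2))
        continuous_toFun := by fun_prop
        map_zero_left := fun x => by simp [hT0, hF]
        map_one_left := fun x => by simp [hF, k]
        prop' := fun t x hx => by
          have : q x = q c := hqb x hx c hc
          have h2 := hT t
          simp only [γ, ContinuousMap.coe_mk] at h2
          simp [this, h2, GenLoop.boundary f x hx] }⟩
      have h2 : GenLoop.Homotopic k g := ⟨{
        toFun := fun p => S (p.1, g p.2)
        continuous_toFun := by fun_prop
        map_zero_left := fun x => by simp [hS0, k]
        map_one_left := fun x => by simp [hS1]
        prop' := fun t x hx => by simp [GenLoop.boundary g x hx, hS, hk x hx] }⟩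
      exact Quotient.sound (h1.trans h2)
    · intro a
      induction a using Quotient.inductionOn with | _ f
      obtain ⟨γ⟩ := PathConnectedSpace.joined x₀ (f (q c))
      obtain ⟨T, hT0, hT, -⟩ := hX γ.toContinuousMap γ.source
      have hqc := hq.continuous
      let k : GenLoop N X x₀ := ⟨⟨fun x => T (1, f (q x)), by fun_prop⟩, fun x hx => by
        have := hT 1
        have h1 : γ.toContinuousMap 1 = f (q c) := γ.target
        rw [h1] at this
        simpa [hqb x hx c hc] using this⟩
      refine ⟨Quotient.mk _ k, Quotient.sound (Joined.symm ?_)⟩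
      refine joined_of_continuous_prod (fun p => T (p.1, f p.2)) (by fun_prop) ?_ ?_
      · intro y
        simp [hT0]
      · intro y
        rw [← hr y, hF]
        rfl
  exact ⟨(Equiv.ofBijective Φ hΦ).symm⟩

end FreeHomotopy

section Intertwiner

open scoped Matrix.Norms.L2Operator
open Matrix

variable {m : Type*} [Fintype m] [DecidableEq m]

theorem spectrum_four_sub_subset [Nonempty m] {E : Matrix m m ℝ} (hE : ‖E‖ ≤ 1) :
    spectrum ℝ (algebraMap ℝ _ 4 - E) ⊆ Set.Icc 3 5 := by
  intro x hx
  have hx' : 4 - x ∈ spectrum ℝ E := by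
    rw [spectrum.mem_iff] at hx ⊢
    intro hu
    apply hx
    have : algebraMap ℝ (Matrix m m ℝ) x - (algebraMap ℝ _ 4 - E) =
        -(algebraMap ℝ (Matrix m m ℝ) (4 - x) - E) := by
      rw [map_sub]; abel
    rw [this]
    exact hu.neg
  have := (spectrum.norm_le_norm_of_mem hx').trans hE
  rw [Real.norm_eq_abs, abs_le] at this
  constructor <;> linarith

/-- Two sufficiently close families of orthogonal complex structures are conjugate by a family of
orthogonal matrices: the orthogonal part of the polar decomposition of `1 - K J`. -/
theorem exists_orthogonal_intertwiner [Nonempty m] {P : Type*} [TopologicalSpace P]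
    {J K : P → Matrix m m ℝ}
    (hJc : Continuous J) (hKc : Continuous K) (hJ : ∀ t, (J t)ᵀ = -J t) (hK : ∀ t, (K t)ᵀ = -K t)
    (hJ2 : ∀ t, J t * J t = -1) (hK2 : ∀ t, K t * K t = -1) (hd : ∀ t, ‖J t - K t‖ ≤ 1) :
    ∃ g : P → Matrix m m ℝ, Continuous g ∧ ∀ t, (g t)ᵀ * g t = 1 ∧ K t * g t = g t * J t ∧
      (J t = K t → g t = 1) := by
  let S : P → Matrix m m ℝ := fun t => algebraMap ℝ _ 4 - -((J t - K t) * (J t - K t))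
  have hS : ∀ t, S t = (1 - J t * K t) * (1 - K t * J t) := fun t => by
    have e : J t * K t * (K t * J t) = 1 := by
      rw [mul_assoc, ← mul_assoc (K t), hK2, neg_one_mul, mul_neg, hJ2, neg_neg]
    simp only [S]
    have e1 : (J t - K t) * (J t - K t) = J t * J t - J t * K t - K t * J t + K t * K t := by
      noncomm_ring
    have e2 : (1 - J t * K t) * (1 - K t * J t)
        = 1 - J t * K t - K t * J t + J t * K t * (K t * J t) := by
      noncomm_ring
    rw [e1, e2, e, hJ2, hK2]
    have : algebraMap ℝ (Matrix m m ℝ) 4 = 1 + 1 + 1 + 1 := by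
      rw [show (4 : ℝ) = 1 + 1 + 1 + 1 by norm_num]
      simp only [map_add, map_one]
    rw [this]
    abel
  have hSs : ∀ t, spectrum ℝ (S t) ⊆ Set.Icc 3 5 := fun t => by
    refine spectrum_four_sub_subset ?_
    rw [norm_neg]
    exact (norm_mul_le _ _).trans (mul_le_one₀ (hd t) (norm_nonneg _) (hd t))
  have hSa : ∀ t, IsSelfAdjoint (S t) := fun t => by
    rw [hS, isSelfAdjoint_iff, star_eq_conjTranspose, conjTranspose_eq_transpose_of_trivial]
    simp [hJ, hK]
  have hSJ : ∀ t, Commute (S t) (J t) := fun t => by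
    have e1 : (1 - K t * J t) * J t = K t * (1 - K t * J t) := by
      rw [sub_mul, mul_sub, mul_assoc, hJ2, ← mul_assoc (K t), hK2]
      simp [add_comm]
    have e2 : (1 - J t * K t) * K t = J t * (1 - J t * K t) := by
      rw [sub_mul, mul_sub, mul_assoc, hK2, ← mul_assoc (J t), hJ2]
      simp [add_comm]
    rw [hS, Commute, SemiconjBy, mul_assoc, e1, ← mul_assoc, e2, mul_assoc]
  let f : ℝ → ℝ := fun x => (√x)⁻¹
  have hf : ContinuousOn f (Set.Icc 3 5) := by
    refine ContinuousOn.inv₀ Real.continuous_sqrt.continuousOn fun x hx => ?_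
    exact (Real.sqrt_pos.2 (by linarith [hx.1])).ne'
  let R : P → Matrix m m ℝ := fun t => cfc f (S t)
  have hSc : Continuous S := by fun_prop
  have hRc : Continuous R := hSc.cfc' isCompact_Icc f hSs hf hSa
  have hRS : ∀ t, R t * S t * R t = 1 := fun t => by
    have hfc := hf.mono (hSs t)
    have h1 : R t * S t = cfc (fun x => f x * x) (S t) := by
      rw [cfc_mul f (fun x => x) (S t) hfc (by fun_prop), cfc_id' ℝ (S t) (hSa t)]
    rw [h1, ← cfc_mul (fun x => f x * x) f (S t) (hfc.mul (by fun_prop)) hfc, ← cfc_one ℝ (S t) (hSa t)]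
    refine cfc_congr fun x hx => ?_
    have hx0 : 0 < x := by linarith [(hSs t hx).1]
    have : √x ≠ 0 := (Real.sqrt_pos.2 hx0).ne'
    simp only [f, Pi.one_apply]
    field_simp
    rw [Real.sq_sqrt hx0.le]
  have hRJ : ∀ t, Commute (R t) (J t) := fun t => (hSJ t).cfc_real f
  have hRT : ∀ t, (R t)ᵀ = R t := fun t => by
    have : IsSelfAdjoint (R t) := cfc_predicate f (S t)
    rwa [isSelfAdjoint_iff, star_eq_conjTranspose, conjTranspose_eq_transpose_of_trivial] at this
  refine ⟨fun t => (1 - K t * J t) * R t, by fun_prop, fun t => ⟨?_, ?_, fun h => ?_⟩⟩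
  · have : (1 - K t * J t)ᵀ = 1 - J t * K t := by simp [hJ, hK]
    rw [transpose_mul, this, hRT, mul_assoc, ← mul_assoc (1 - J t * K t), ← hS, ← mul_assoc, hRS]
  · rw [mul_assoc, (hRJ t).eq, ← mul_assoc, ← mul_assoc]
    congr 1
    rw [sub_mul, mul_sub, mul_assoc, hJ2, ← mul_assoc (K t), hK2]
    simp [add_comm]
  · have h4 : S t = algebraMap ℝ _ 4 := by simp [S, h]
    have hR : R t = algebraMap ℝ _ (2⁻¹) := by
      simp only [R]
      rw [h4, cfc_algebraMap]
      congr 1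
      simp only [f]
      rw [show (4 : ℝ) = 2 ^ 2 by norm_num, Real.sqrt_sq zero_le_two]
    dsimp only
    rw [h, hK2, hR, Algebra.algebraMap_eq_smul_one, mul_smul_comm, mul_one, sub_neg_eq_add,
      ← two_smul ℝ (1 : Matrix m m ℝ), smul_smul]
    norm_num

/-- A path of orthogonal complex structures lifts to a path of orthogonal matrices. -/
theorem exists_orthogonal_lift [Nonempty m] {J : I → Matrix m m ℝ} (hJc : Continuous J)
    (hJ : ∀ t, (J t)ᵀ = -J t) (hJ2 : ∀ t, J t * J t = -1) :
    ∃ g : I → Matrix m m ℝ, Continuous g ∧ g 0 = 1 ∧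
      ∀ t, (g t)ᵀ * g t = 1 ∧ J t * g t = g t * J 0 := by
  have huc := CompactSpace.uniformContinuous_of_continuous hJc
  obtain ⟨δ, hδ, hJd⟩ := Metric.uniformContinuous_iff.1 huc 1 one_pos
  obtain ⟨k, hk⟩ := exists_nat_one_div_lt hδ
  let p : ℕ → I → I := fun i t => Set.projIcc 0 1 zero_le_one (min (t : ℝ) (i / (k + 1)))
  have hpc : ∀ i, Continuous (p i) := fun i => by fun_prop
  have hpd : ∀ i t, dist (p (i + 1) t) (p i t) < δ := fun i t => by
    refine lt_of_le_of_lt ?_ hk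
    rw [Subtype.dist_eq, Real.dist_eq]
    simp only [p]
    refine (Set.abs_projIcc_sub_projIcc (α := ℝ) zero_le_one).trans ?_
    refine (abs_min_sub_min_le_max _ _ _ _).trans ?_
    rw [sub_self, abs_zero, ← sub_div, Nat.cast_add_one, add_sub_cancel_left,
      abs_of_nonneg (by positivity)]
    exact max_le (by positivity) le_rfl
  have hp0 : ∀ i, p i 0 = 0 := fun i => by
    simp only [p, Set.Icc.coe_zero]
    rw [min_eq_left (by positivity)]
    exact Set.projIcc_left zero_le_one
  have key : ∀ i, ∃ g : I → Matrix m m ℝ, Continuous g ∧ g 0 = 1 ∧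
      ∀ t, (g t)ᵀ * g t = 1 ∧ J (p i t) * g t = g t * J 0 := by
    intro i
    induction i with
    | zero =>
      refine ⟨fun _ => 1, continuous_const, rfl, fun t => ⟨by simp, ?_⟩⟩
      have : p 0 t = 0 := by
        simp only [p, Nat.cast_zero, zero_div]
        rw [min_eq_right t.2.1]
        exact Set.projIcc_left zero_le_one
      simp [this]
    | succ i ih =>
      obtain ⟨g, hgc, hg0, hg⟩ := ih
      obtain ⟨a, hac, ha⟩ := exists_orthogonal_intertwiner (hJc.comp (hpc i))
        (hJc.comp (hpc (i + 1))) (fun t => hJ _) (fun t => hJ _) (fun t => hJ2 _)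
        (fun t => hJ2 _) (fun t => by
          rw [← dist_eq_norm, dist_comm]
          exact (hJd (hpd i t)).le)
      refine ⟨fun t => a t * g t, by fun_prop, ?_, fun t => ⟨?_, ?_⟩⟩
      · dsimp only
        rw [hg0, (ha 0).2.2 (by simp [hp0]), mul_one]
      · rw [transpose_mul, mul_assoc, ← mul_assoc _ (a t), (ha t).1, one_mul, (hg t).1]
      · have := (ha t).2.1
        simp only [Function.comp_apply] at this
        rw [← mul_assoc, this, mul_assoc, (hg t).2, mul_assoc]
  obtain ⟨g, hgc, hg0, hg⟩ := key (k + 1)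
  refine ⟨g, hgc, hg0, fun t => ⟨(hg t).1, ?_⟩⟩
  have : p (k + 1) t = t := by
    simp only [p]
    rw [Nat.cast_add_one, div_self (by positivity), min_eq_left t.2.2]
    exact Set.projIcc_val _ t
  rw [← (hg t).2, this]

end Intertwiner

section UnitaryGroup

open scoped Matrix.Norms.L2Operator
open Matrix

open Complex in
theorem expUnitary_argSelfAdjoint_of_continuousOn {A : Type*} [CStarAlgebra A] {u : unitary A}
    (hu : ContinuousOn arg (spectrum ℂ (u : A))) :
    selfAdjoint.expUnitary (Unitary.argSelfAdjoint u) = u := by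
  ext1
  rw [selfAdjoint.expUnitary_coe, Unitary.argSelfAdjoint_coe,
    ← CFC.exp_eq_normedSpace_exp (𝕜 := ℂ), ← cfc_comp_smul .., ← cfc_comp' ..]
  conv_rhs => rw [← cfc_id' ℂ (u : A)]
  refine cfc_congr fun y hy => ?_
  have hy1 : ‖y‖ = 1 := spectrum.norm_eq_one_of_unitary u.2 hy
  have hlog : Complex.I * y.arg = Complex.log y :=
    Complex.ext (by simp [Complex.log_re, hy1]) (by simp [Complex.log_im])
  have hy0 : y ≠ 0 := by
    rintro rfl
    simp at hy1
  simpa [← Complex.exp_eq_exp_ℂ, hlog] using Complex.exp_log hy0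

variable {m : Type*} [Fintype m] [DecidableEq m]

theorem joined_one_unitary_matrix (u : unitary (Matrix m m ℂ)) : Joined 1 u := by
  rw [← expUnitary_argSelfAdjoint_of_continuousOn (u := u)
    ((Matrix.finite_spectrum _).continuousOn _)]
  exact selfAdjoint.joined_one_expUnitary _

/-- The real matrix underlying a complex matrix. -/
def realify (M : Matrix m m ℂ) : Matrix (m ⊕ m) (m ⊕ m) ℝ :=
  fromBlocks (M.map Complex.re) (-M.map Complex.im) (M.map Complex.im) (M.map Complex.re)

omit [Fintype m] [DecidableEq m] in
theorem continuous_realify : Continuous (realify (m := m)) := by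
  unfold realify
  have h1 : Continuous fun M : Matrix m m ℂ => M.map Complex.re :=
    continuous_id.matrix_map Complex.continuous_re
  have h2 : Continuous fun M : Matrix m m ℂ => M.map Complex.im :=
    continuous_id.matrix_map Complex.continuous_im
  exact h1.matrix_fromBlocks h2.neg h2 h1

omit [Fintype m] in
theorem realify_one : realify (1 : Matrix m m ℂ) = 1 := by
  ext (i | i) (j | j) <;> by_cases h : i = j <;> simp [realify, one_apply, h]

omit [DecidableEq m] in
theorem realify_mul (A B : Matrix m m ℂ) : realify (A * B) = realify A * realify B := by
  rw [realify, realify, realify, fromBlocks_multiply]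
  congr 1 <;> ext i j <;>
    simp [mul_apply, Finset.sum_add_distrib, Finset.sum_neg_distrib,
      sub_eq_add_neg, add_comm]

omit [Fintype m] [DecidableEq m] in
theorem realify_conjTranspose (A : Matrix m m ℂ) : realify Aᴴ = (realify A)ᵀ := by
  ext (i | i) (j | j) <;> simp [realify]

theorem commute_realify_J0 {n : ℕ} (M : Matrix (Fin n) (Fin n) ℂ) :
    Commute (realify M) (J0 n) := by
  simp [Commute, SemiconjBy, realify, J0, fromBlocks_multiply]

theorem exists_realify_eq {n : ℕ} {A : Matrix (Fin n ⊕ Fin n) (Fin n ⊕ Fin n) ℝ}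
    (hA : Commute A (J0 n)) : ∃ M, realify M = A := by
  refine ⟨of fun i j => ⟨A (.inl i) (.inl j), A (.inr i) (.inl j)⟩, ?_⟩
  rw [← fromBlocks_toBlocks A, Commute, SemiconjBy, J0, fromBlocks_multiply, fromBlocks_multiply,
    fromBlocks_inj] at hA
  simp only [mul_zero, mul_one, zero_add, mul_neg, add_zero, zero_mul, neg_mul, one_mul] at hA
  obtain ⟨h1, h2, -, -⟩ := hA
  conv_rhs => rw [← fromBlocks_toBlocks A]
  rw [h1, ← neg_neg A.toBlocks₂₂, ← h2.trans rfl, neg_neg]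
  rfl

omit [Fintype m] [DecidableEq m] in
theorem realify_injective : Function.Injective (realify (m := m)) := by
  intro A B h
  rw [realify, realify, fromBlocks_inj] at h
  ext i j
  exact Complex.ext (congrFun (congrFun h.1 i) j) (congrFun (congrFun h.2.2.1 i) j)

/-- The stabilizer of `J₀` in the orthogonal group, that is `U(n)`, is path connected. -/
theorem exists_path_stabilizer {n : ℕ} {A : Matrix (Fin n ⊕ Fin n) (Fin n ⊕ Fin n) ℝ}
    (hA : Commute A (J0 n)) (hA1 : Aᵀ * A = 1) :
    ∃ h : I → Matrix (Fin n ⊕ Fin n) (Fin n ⊕ Fin n) ℝ, Continuous h ∧ h 0 = 1 ∧ h 1 = A ∧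
      ∀ t, (h t)ᵀ * h t = 1 ∧ Commute (h t) (J0 n) := by
  obtain ⟨M, rfl⟩ := exists_realify_eq hA
  have hM : star M * M = 1 := by
    apply realify_injective
    rw [realify_mul, star_eq_conjTranspose, realify_conjTranspose, hA1, realify_one]
  obtain ⟨P⟩ := joined_one_unitary_matrix
    (⟨M, Unitary.mem_iff.2 ⟨hM, mul_eq_one_comm.1 hM⟩⟩ : unitary (Matrix (Fin n) (Fin n) ℂ))
  refine ⟨fun t => realify (P t : Matrix (Fin n) (Fin n) ℂ),
    continuous_realify.comp (continuous_subtype_val.comp P.continuous), ?_, ?_, fun t =>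
    ⟨?_, commute_realify_J0 _⟩⟩
  · simp [realify_one]
  · simp
  · rw [← realify_conjTranspose, ← realify_mul, ← star_eq_conjTranspose,
      Unitary.star_mul_self_of_mem (P t).2, realify_one]

end UnitaryGroup

section ComplexStructures

open Matrix

theorem transpose_eq_neg_of_mem_Gamma {n : ℕ} {J : Matrix (Fin n ⊕ Fin n) (Fin n ⊕ Fin n) ℝ}
    (hJ : J ∈ Gamma n) : Jᵀ = -J := by
  have h := congrArg (· * J) hJ.1
  simpa [mul_assoc, hJ.2, neg_eq_iff_eq_neg] using h

theorem conj_mem_Gamma {n : ℕ} {g J : Matrix (Fin n ⊕ Fin n) (Fin n ⊕ Fin n) ℝ}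
    (hg : gᵀ * g = 1) (hJ : J ∈ Gamma n) : gᵀ * J * g ∈ Gamma n := by
  have hg' : g * gᵀ = 1 := mul_eq_one_comm.1 hg
  constructor
  · calc (gᵀ * J * g)ᵀ * (gᵀ * J * g) = gᵀ * Jᵀ * (g * gᵀ) * J * g := by
          simp [mul_assoc]
      _ = gᵀ * (Jᵀ * J) * g := by simp [hg', mul_assoc]
      _ = 1 := by rw [hJ.1, mul_one, hg]
  · calc gᵀ * J * g * (gᵀ * J * g) = gᵀ * J * (g * gᵀ) * J * g := by
          simp [mul_assoc]
      _ = gᵀ * (J * J) * g := by simp [hg', mul_assoc]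
      _ = -1 := by rw [hJ.2, mul_neg, mul_one, neg_mul, hg]

/-- Conjugation by a path of orthogonal matrices starting at `1` acts on `Γ_n⁺`. -/
theorem exists_conj_action {n : ℕ} {g : I → Matrix (Fin n ⊕ Fin n) (Fin n ⊕ Fin n) ℝ}
    (hgc : Continuous g) (hg0 : g 0 = 1) (hg : ∀ t, (g t)ᵀ * g t = 1) :
    ∃ T : C(I × GammaPlus n, GammaPlus n), ∀ t J,
      (T (t, J)).1.1 = (g t)ᵀ * J.1.1 * g t := by
  let T₀ : I × Gamma n → Gamma n := fun p =>
    ⟨(g p.1)ᵀ * p.2.1 * g p.1, conj_mem_Gamma (hg p.1) p.2.2⟩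
  have hT₀ : Continuous T₀ := by
    refine Continuous.subtype_mk ?_ _
    have h1 : Continuous fun p : I × Gamma n => g p.1 := hgc.comp continuous_fst
    have h2 : Continuous fun p : I × Gamma n => p.2.1 := continuous_subtype_val.comp continuous_snd
    exact (h1.matrix_transpose.matrix_mul h2).matrix_mul h1
  have : PathConnectedSpace I :=
    isPathConnected_iff_pathConnectedSpace.1 ((convex_Icc 0 1).isPathConnected ⟨0, by simp⟩)
  have hmem : ∀ t (J : GammaPlus n), T₀ (t, J.1) ∈ GammaPlus n := fun t J => by
    have hj : Joined (T₀ (0, J.1)) (T₀ (t, J.1)) :=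
      ((PathConnectedSpace.joined 0 t).map (f := fun s => T₀ (s, J.1)) (by fun_prop))
    have h0 : T₀ (0, J.1) = J.1 := Subtype.ext (by simp [T₀, hg0])
    rw [h0] at hj
    exact Joined.trans J.2 hj
  exact ⟨⟨fun p => ⟨T₀ (p.1, p.2.1), hmem p.1 p.2⟩, by fun_prop⟩, fun t J => rfl⟩

theorem exists_isotopy_gammaPlus {n : ℕ} (γ : C(I, GammaPlus (n + 1)))
    (hγ : γ 0 = J0plus (n + 1)) :
    ∃ T : C(I × GammaPlus (n + 1), GammaPlus (n + 1)), (∀ x, T (0, x) = x) ∧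
      (∀ t, T (t, γ t) = J0plus (n + 1)) ∧ (γ 1 = J0plus (n + 1) →
        ∃ S : C(I × GammaPlus (n + 1), GammaPlus (n + 1)), (∀ x, S (0, x) = T (1, x)) ∧
          (∀ x, S (1, x) = x) ∧ ∀ s, S (s, J0plus (n + 1)) = J0plus (n + 1)) := by
  have hγc : Continuous fun t => (γ t).1.1 :=
    continuous_subtype_val.comp (continuous_subtype_val.comp γ.continuous)
  obtain ⟨g, hgc, hg0, hg⟩ := exists_orthogonal_lift hγc
    (fun t => transpose_eq_neg_of_mem_Gamma (γ t).1.2) (fun t => (γ t).1.2.2)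
  have hγ0 : (γ 0).1.1 = J0 (n + 1) := by rw [hγ]; rfl
  rw [hγ0] at hg
  obtain ⟨T, hT⟩ := exists_conj_action hgc hg0 fun t => (hg t).1
  refine ⟨T, fun x => ?_, fun t => ?_, fun h => ?_⟩
  · apply Subtype.ext
    apply Subtype.ext
    simp [hT, hg0]
  · apply Subtype.ext
    apply Subtype.ext
    rw [hT, mul_assoc, (hg t).2, ← mul_assoc, (hg t).1, one_mul]
    rfl
  · have hcomm : Commute (g 1) (J0 (n + 1)) := by
      have h1 := (hg 1).2
      rw [h] at h1
      exact h1.symm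
    obtain ⟨k, hkc, hk0, hk1, hk⟩ := exists_path_stabilizer hcomm (hg 1).1
    obtain ⟨S, hS⟩ := exists_conj_action hkc hk0 fun t => (hk t).1
    refine ⟨⟨fun p => S (unitInterval.symm p.1, p.2), by fun_prop⟩, fun x => ?_, fun x => ?_,
      fun s => ?_⟩
    · apply Subtype.ext
      apply Subtype.ext
      simp [hS, hT, hk1]
    · apply Subtype.ext
      apply Subtype.ext
      simp [hS, hk0]
    · apply Subtype.ext
      apply Subtype.ext
      change (S (unitInterval.symm s, J0plus (n + 1))).1.1 = J0 (n + 1)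
      rw [hS, mul_assoc]
      change _ * (J0 (n + 1) * _) = _
      rw [← (hk _).2.eq, ← mul_assoc, (hk _).1, one_mul]

end ComplexStructures

/-- There is a bijection between the set of path components of
`C(S^{2n+1}, Γ_{n+1}⁺)` and the homotopy group `π_{2n+1}(Γ_{n+1}⁺, J₀)`. -/
theorem stmt3 (n : ℕ) (hn : 1 ≤ n) :
    Nonempty (ZerothHomotopy C(Sph (2 * n + 1), GammaPlus (n + 1)) ≃
      π_ (2 * n + 1) (GammaPlus (n + 1)) (J0plus (n + 1))) := by
  have : PathConnectedSpace (GammaPlus (n + 1)) :=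
    isPathConnected_iff_pathConnectedSpace.1 isPathConnected_pathComponent
  let e : OnePoint (Fin (2 * n + 1) → ℝ) ≃ₜ Sph (2 * n + 1) :=
    onePointEquivSphereOfFinrankEq (by simp)
  have hq : Continuous (e ∘ cubeCollapse) := e.continuous.comp continuous_cubeCollapse
  have hqs : Function.Surjective (e ∘ cubeCollapse) := e.surjective.comp cubeCollapse_surjective
  have : CompactSpace (Sph (2 * n + 1)) := e.compactSpace
  refine nonempty_zerothHomotopy_equiv_homotopyGroup _ (e ∘ cubeCollapse)
    (.of_surjective_continuous hqs hq) (fun x hx y hy => ?_) (fun x y h => ?_)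
    ⟨0, 0, Or.inl rfl⟩ exists_isotopy_gammaPlus
  · simp only [Function.comp_apply]
    rw [(cubeCollapse_eq_infty_iff x).2 hx, (cubeCollapse_eq_infty_iff y).2 hy]
  · have h' := e.injective h
    by_cases hx : x ∈ Cube.boundary (Fin (2 * n + 1))
    · refine Or.inr ⟨hx, ?_⟩
      rwa [← cubeCollapse_eq_infty_iff, ← h', cubeCollapse_eq_infty_iff]
    · refine Or.inl (cubeCollapse_injOn_compl_boundary hx ?_ h')
      rwa [Set.mem_compl_iff, ← cubeCollapse_eq_infty_iff, ← h', cubeCollapse_eq_infty_iff]
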